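/- Let n ≥ 1 be an integer and let 𝔹_n(x) be the n×n matrix over ℤ[x] whose (i,j) entry (0 ≤ i, j ≤ n−1) is the Bell polynomial b_{i+j}(x). Then det 𝔹_n(x) = ( Π_{j=0}^{n−1} j! ) · x^{n(n−1)/2}. -/

import Mathlib

/-- Stirling numbers of the second kind. -/
def stirling2 : ℕ → ℕ → ℕ
  | 0, 0 => 1
  | 0, _ + 1 => 0
  | _ + 1, 0 => 0
  | n + 1, j + 1 => (j + 1) * stirling2 n (j + 1) + stirling2 n j

/-- Evaluation of the Bell polynomial `b_n(x) = ∑_j S(n,j) x^j`. -/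
def bellEval {R : Type*} [CommRing R] (n : ℕ) (x : R) : R :=
  ∑ j ∈ Finset.range (n + 1), (stirling2 n j : R) * x ^ j

theorem stirling2_eq_zero_of_lt : ∀ {n j : ℕ}, n < j → stirling2 n j = 0
  | 0, _ + 1, _ => by rw [stirling2]
  | n + 1, j + 1, h => by
    rw [stirling2, stirling2_eq_zero_of_lt (by omega : n < j + 1),
      stirling2_eq_zero_of_lt (by omega : n < j), mul_zero]

theorem stirling2_self (n : ℕ) : stirling2 n n = 1 := by
  induction n with
  | zero => rw [stirling2]
  | succ n ih => rw [stirling2, stirling2_eq_zero_of_lt n.lt_succ_self, ih, mul_zero]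

namespace BellPolynomial

open Polynomial

theorem coeff_bellEval_X (n j : ℕ) :
    (bellEval n (X : ℤ[X])).coeff j = stirling2 n j := by
  simp only [bellEval, finsetSum_coeff, coeff_natCast_mul, coeff_X_pow, mul_ite, mul_one,
    mul_zero, Finset.sum_ite_eq, Finset.mem_range]
  split_ifs with h
  · rfl
  · rw [stirling2_eq_zero_of_lt (by omega), Nat.cast_zero]

theorem bellEval_X_zero : bellEval 0 (X : ℤ[X]) = 1 := by
  simp [bellEval, stirling2]

theorem bellEval_X_succ (n : ℕ) :
    bellEval (n + 1) (X : ℤ[X]) = X * (bellEval n X + derivative (bellEval n X)) := by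
  ext (_ | j)
  · simp [coeff_bellEval_X, stirling2]
  · rw [coeff_X_mul, coeff_add, coeff_derivative, coeff_bellEval_X, coeff_bellEval_X,
      coeff_bellEval_X, stirling2]
    push_cast
    ring

theorem natDegree_bellEval_X_le (n : ℕ) : (bellEval n (X : ℤ[X])).natDegree ≤ n := by
  refine natDegree_le_iff_coeff_eq_zero.2 fun j hj => ?_
  rw [coeff_bellEval_X, stirling2_eq_zero_of_lt hj, Nat.cast_zero]

theorem hasseDeriv_bellEval_X_eq_zero {n k : ℕ} (h : n < k) :
    hasseDeriv k (bellEval n (X : ℤ[X])) = 0 :=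
  hasseDeriv_eq_zero_of_lt_natDegree _ _ ((natDegree_bellEval_X_le n).trans_lt h)

theorem hasseDeriv_bellEval_X_self (n : ℕ) :
    hasseDeriv n (bellEval n (X : ℤ[X])) = 1 := by
  ext j
  rw [hasseDeriv_coeff, coeff_bellEval_X, coeff_one]
  rcases j with _ | j
  · simp [stirling2_self]
  · simp [stirling2_eq_zero_of_lt (by omega : n < j + 1 + n)]

theorem hasseDeriv_succ_X_mul {R : Type*} [CommRing R] (k : ℕ) (p : R[X]) :
    hasseDeriv (k + 1) (X * p) = X * hasseDeriv (k + 1) p + hasseDeriv k p := by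
  ext (_ | j)
  · simp [hasseDeriv_coeff, coeff_X_mul, ← add_assoc]
  · rw [coeff_add, coeff_X_mul, hasseDeriv_coeff, hasseDeriv_coeff, hasseDeriv_coeff,
      show j + 1 + (k + 1) = j + k + 1 + 1 by ring, coeff_X_mul, Nat.choose_succ_succ,
      show j + (k + 1) = j + k + 1 by ring, show j + 1 + k = j + k + 1 by ring]
    push_cast
    ring

theorem hasseDeriv_derivative {R : Type*} [CommRing R] (k : ℕ) (p : R[X]) :
    hasseDeriv k (derivative p) = (k + 1) * hasseDeriv (k + 1) p := by
  have h := congrArg (fun f => f p) (hasseDeriv_comp (R := R) k 1)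
  simpa [hasseDeriv_one, Nat.choose_succ_self_right, add_mul] using h

theorem hasseDeriv_zero_bellEval_X_succ (n : ℕ) :
    hasseDeriv 0 (bellEval (n + 1) (X : ℤ[X])) =
      X * (hasseDeriv 0 (bellEval n X) + hasseDeriv 1 (bellEval n X)) := by
  simp [bellEval_X_succ, hasseDeriv_one]

theorem hasseDeriv_succ_bellEval_X_succ (n k : ℕ) :
    hasseDeriv (k + 1) (bellEval (n + 1) (X : ℤ[X])) =
      hasseDeriv k (bellEval n X) + ((k : ℤ[X]) + 1 + X) * hasseDeriv (k + 1) (bellEval n X) +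
        ((k : ℤ[X]) + 2) * X * hasseDeriv (k + 2) (bellEval n X) := by
  rw [bellEval_X_succ, hasseDeriv_succ_X_mul, map_add, map_add, hasseDeriv_derivative,
    hasseDeriv_derivative]
  push_cast
  ring

/-- A Christoffel–Darboux type identity, by telescoping. -/
theorem sum_hasseDeriv_bellEval_X_succ_mul (m l N : ℕ) :
    ∑ k ∈ Finset.range (N + 1), (k.factorial : ℤ[X]) * X ^ k *
        (hasseDeriv k (bellEval (m + 1) X) * hasseDeriv k (bellEval l X)) =
      ∑ k ∈ Finset.range (N + 1), (k.factorial : ℤ[X]) * X ^ k *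
        (hasseDeriv k (bellEval m X) * hasseDeriv k (bellEval (l + 1) X)) +
      ((N + 1).factorial : ℤ[X]) * X ^ (N + 1) *
        (hasseDeriv (N + 1) (bellEval m X) * hasseDeriv N (bellEval l X) -
          hasseDeriv N (bellEval m X) * hasseDeriv (N + 1) (bellEval l X)) := by
  induction N with
  | zero =>
    simp only [zero_add, Finset.sum_range_one, hasseDeriv_zero_bellEval_X_succ,
      Nat.factorial_zero, Nat.factorial_one, Nat.cast_one]
    ring
  | succ N ih =>
    rw [Finset.sum_range_succ, ih, Finset.sum_range_succ _ (N + 1),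
      hasseDeriv_succ_bellEval_X_succ, hasseDeriv_succ_bellEval_X_succ,
      Nat.factorial_succ (N + 1)]
    push_cast
    ring

theorem sum_hasseDeriv_bellEval_X_mul {m N : ℕ} (hm : m ≤ N) (l : ℕ) :
    ∑ k ∈ Finset.range (N + 1), (k.factorial : ℤ[X]) * X ^ k *
        (hasseDeriv k (bellEval m X) * hasseDeriv k (bellEval l X)) =
      bellEval (m + l) X := by
  induction m generalizing l with
  | zero =>
    rw [Finset.sum_range_succ', Finset.sum_eq_zero fun k _ => by
      rw [hasseDeriv_bellEval_X_eq_zero k.succ_pos, zero_mul, mul_zero]]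
    simp [bellEval_X_zero]
  | succ m ih =>
    rw [sum_hasseDeriv_bellEval_X_succ_mul, ih (by omega),
      hasseDeriv_bellEval_X_eq_zero (by omega : m < N + 1),
      hasseDeriv_bellEval_X_eq_zero (by omega : m < N), add_right_comm m 1 l, add_assoc m l 1]
    ring

end BellPolynomial

/-- The Hankel determinant formula:
`det (b_{i+j}(x))_{0 ≤ i,j ≤ n-1} = (∏_{j=0}^{n-1} j!) x^{n(n-1)/2}` in `ℤ[x]`. -/
theorem bell_hankel_determinant (n : ℕ) (hn : 1 ≤ n) :
    Matrix.det (Matrix.of fun i j : Fin n =>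
        bellEval ((i : ℕ) + (j : ℕ)) (Polynomial.X : Polynomial ℤ)) =
      Polynomial.C (∏ j ∈ Finset.range n, (Nat.factorial j : ℤ)) *
        (Polynomial.X : Polynomial ℤ) ^ (n * (n - 1) / 2) := by
  obtain ⟨N, rfl⟩ : ∃ N, n = N + 1 := ⟨n - 1, by omega⟩
  let L : Matrix (Fin (N + 1)) (Fin (N + 1)) (Polynomial ℤ) :=
    Matrix.of fun i k => Polynomial.hasseDeriv k (bellEval i Polynomial.X)
  let d : Fin (N + 1) → Polynomial ℤ := fun k => ((k : ℕ).factorial : Polynomial ℤ) *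
    Polynomial.X ^ (k : ℕ)
  have hL : L.det = 1 := by
    rw [Matrix.det_of_isLowerTriangular L fun i k h =>
      BellPolynomial.hasseDeriv_bellEval_X_eq_zero (Fin.lt_def.1 h)]
    exact Finset.prod_eq_one fun i _ => BellPolynomial.hasseDeriv_bellEval_X_self i
  have hB : (Matrix.of fun i j : Fin (N + 1) =>
      bellEval ((i : ℕ) + (j : ℕ)) (Polynomial.X : Polynomial ℤ)) =
        L * Matrix.diagonal d * L.transpose := by
    ext1 i j
    rw [Matrix.of_apply, Matrix.mul_apply,
      ← BellPolynomial.sum_hasseDeriv_bellEval_X_mul (Nat.le_of_lt_succ i.isLt),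
      Finset.sum_range]
    refine Finset.sum_congr rfl fun k _ => ?_
    rw [Matrix.mul_diagonal, Matrix.transpose_apply]
    simp only [L, d, Matrix.of_apply]
    ring
  rw [hB, Matrix.det_mul, Matrix.det_mul, Matrix.det_transpose, Matrix.det_diagonal, hL,
    one_mul, mul_one, Finset.prod_mul_distrib, Finset.prod_pow_eq_pow_sum,
    ← Finset.prod_range fun k => (k.factorial : Polynomial ℤ), ← Finset.sum_range fun k => k,
    Finset.sum_range_id, map_prod]
  simp
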